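/- Let q be a prime power, K a finite field with q elements, K̄ an algebraic closure of K, and φ the Frobenius map on P¹(K̄) given by [a : b] ↦ [a^q : b^q]. The number of orbits of the componentwise action of PGL₂(K) on the set of ordered 6-tuples (x₁, …, x₆) of pairwise distinct points of P¹(K̄) satisfying φ(x₁) = x₂, φ(x₂) = x₁, φ(x₃) = x₄, φ(x₄) = x₃, φ(x₅) = x₆ and φ(x₆) = x₅ equals q³ − 3q² − 2q + 8. -/

import Mathlib

open Projectivization

/-! ## The projective line and the actions of `GL₂` and `PGL₂` -/

/-- `GL₂(L)` as a group of linear automorphisms of `L²`. -/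
noncomputable def glMulEquiv (L : Type*) [Field L] :
    GL (Fin 2) L ≃* ((Fin 2 → L) ≃ₗ[L] (Fin 2 → L)) :=
  (Matrix.GeneralLinearGroup.toLin).trans
    (LinearMap.GeneralLinearGroup.generalLinearEquiv L (Fin 2 → L))

theorem glMulEquiv_apply (L : Type*) [Field L] (g : GL (Fin 2) L) (v : Fin 2 → L) :
    glMulEquiv L g v = (g : Matrix (Fin 2) (Fin 2) L).mulVec v := by
  simp [glMulEquiv]

/-- The action of `GL₂(L)` on the projective line `P¹(L)`, given in homogeneous
coordinates by `[a : b] ↦ [α a + β b : γ a + δ b]`. -/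
noncomputable def glP1 (L : Type*) [Field L] :
    GL (Fin 2) L →* Function.End (Projectivization L (Fin 2 → L)) where
  toFun g := Projectivization.map (glMulEquiv L g).toLinearMap (glMulEquiv L g).injective
  map_one' := by
    funext x
    induction x using Projectivization.ind with
    | h v hv =>
      show Projectivization.map (glMulEquiv L 1).toLinearMap (glMulEquiv L 1).injective
          (Projectivization.mk L v hv) = Projectivization.mk L v hv
      rw [Projectivization.map_mk, Projectivization.mk_eq_mk_iff']
      exact ⟨1, by simp [glMulEquiv_apply]⟩
  map_mul' g h := by
    funext x
    induction x using Projectivization.ind with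
    | h v hv =>
      show Projectivization.map (glMulEquiv L (g * h)).toLinearMap
          (glMulEquiv L (g * h)).injective (Projectivization.mk L v hv)
        = Projectivization.map (glMulEquiv L g).toLinearMap (glMulEquiv L g).injective
            (Projectivization.map (glMulEquiv L h).toLinearMap (glMulEquiv L h).injective
              (Projectivization.mk L v hv))
      rw [Projectivization.map_mk, Projectivization.map_mk, Projectivization.map_mk,
        Projectivization.mk_eq_mk_iff']
      exact ⟨1, by simp [glMulEquiv_apply, Matrix.mulVec_mulVec]⟩

/-- The action of `GL₂(L)` on `P¹(L)` as a `MulAction`. -/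
noncomputable instance glP1Action (L : Type*) [Field L] :
    MulAction (GL (Fin 2) L) (Projectivization L (Fin 2 → L)) :=
  MulAction.ofEndHom (glP1 L)

/-- The subgroup of scalar matrices inside `GL₂(L)`. -/
def scalarSubgroup (L : Type*) [Field L] : Subgroup (GL (Fin 2) L) :=
  (Units.map ((Matrix.scalar (Fin 2)) : L →+* Matrix (Fin 2) (Fin 2) L).toMonoidHom).range

instance scalarSubgroup_normal (L : Type*) [Field L] : (scalarSubgroup L).Normal := by
  constructor
  rintro n ⟨a, rfl⟩ g
  refine ⟨a, ?_⟩
  have hc : Commute (Units.map ((Matrix.scalar (Fin 2)) :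
      L →+* Matrix (Fin 2) (Fin 2) L).toMonoidHom a) g := by
    apply Units.ext
    simpa using (Matrix.scalar_commute (a : L) (fun r => mul_comm _ _)
      (g : Matrix (Fin 2) (Fin 2) L)).eq
  rw [← hc.eq, mul_assoc, mul_inv_cancel, mul_one]

/-- `PGL₂(K)`: the quotient of `GL₂(K)` by the subgroup of scalar matrices. -/
abbrev PGL2 (K : Type*) [Field K] := GL (Fin 2) K ⧸ scalarSubgroup K

/-- Scalar matrices act trivially on the projective line. -/
theorem glP1_scalar_eq_one (L : Type*) [Field L] (a : Lˣ) :
    glP1 L (Units.map ((Matrix.scalar (Fin 2)) :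
      L →+* Matrix (Fin 2) (Fin 2) L).toMonoidHom a) = 1 := by
  set u := Units.map ((Matrix.scalar (Fin 2)) :
      L →+* Matrix (Fin 2) (Fin 2) L).toMonoidHom a with hu
  funext x
  induction x using Projectivization.ind with
  | h v hv =>
    show Projectivization.map (glMulEquiv L u).toLinearMap (glMulEquiv L u).injective
        (Projectivization.mk L v hv) = Projectivization.mk L v hv
    rw [Projectivization.map_mk, Projectivization.mk_eq_mk_iff']
    refine ⟨(a : L), ?_⟩
    simp [glMulEquiv_apply, hu, Matrix.scalar_apply, Matrix.diagonal_const_mulVec]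

/-- For a field homomorphism `f : K →+* L`, the scalar matrices of `GL₂(K)` act trivially on
`P¹(L)`, hence the action of `GL₂(K)` on `P¹(L)` descends to an action of `PGL₂(K)`. -/
noncomputable def pglP1 {K L : Type*} [Field K] [Field L] (f : K →+* L) :
    PGL2 K →* Function.End (Projectivization L (Fin 2 → L)) :=
  QuotientGroup.lift (scalarSubgroup K)
    ((glP1 L).comp (Matrix.GeneralLinearGroup.map f))
    (by
      rintro z ⟨a, rfl⟩
      have key : Matrix.GeneralLinearGroup.map (n := Fin 2) f
          (Units.map ((Matrix.scalar (Fin 2)) : K →+* Matrix (Fin 2) (Fin 2) K).toMonoidHom a)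
          = Units.map ((Matrix.scalar (Fin 2)) :
              L →+* Matrix (Fin 2) (Fin 2) L).toMonoidHom (Units.map f.toMonoidHom a) := by
        apply Units.ext
        ext i j
        simp [Matrix.GeneralLinearGroup.map, Matrix.scalar_apply, Matrix.diagonal,
          Matrix.map_apply, apply_ite f]
      rw [MonoidHom.mem_ker, MonoidHom.comp_apply, key, glP1_scalar_eq_one])

/-- The action of `PGL₂(K)` on `P¹(L)`, for any extension `L` of `K` via `f : K →+* L`. -/
noncomputable def pglP1Action {K L : Type*} [Field K] [Field L] (f : K →+* L) :
    MulAction (PGL2 K) (Projectivization L (Fin 2 → L)) :=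
  MulAction.ofEndHom (pglP1 f)
/-- The Frobenius map on the projective line `P¹(L)`, acting in homogeneous coordinates by
`[a : b] ↦ [a ^ q : b ^ q]`. -/
noncomputable def frobP1 {L : Type*} [Field L] (q : ℕ)
    (x : Projectivization L (Fin 2 → L)) : Projectivization L (Fin 2 → L) :=
  Projectivization.mk L (fun i => (x.rep i) ^ q) (by
    intro hzero
    obtain ⟨i, hi⟩ := Function.ne_iff.mp x.rep_nonzero
    have h2 : x.rep i ^ q = 0 := congrFun hzero i
    exact hi (by simpa using (pow_eq_zero_iff'.mp h2).1))

noncomputable instance pglP1ClosureAction (K : Type*) [Field K] :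
    MulAction (PGL2 K)
      (Projectivization (AlgebraicClosure K) (Fin 2 → AlgebraicClosure K)) :=
  pglP1Action (algebraMap K (AlgebraicClosure K))

theorem frobP1_mk {L : Type*} [Field L] (q : ℕ) (v : Fin 2 → L) (hv : v ≠ 0)
    (hv' : (fun i => v i ^ q) ≠ 0) :
    frobP1 q (mk L v hv) = mk L (fun i => v i ^ q) hv' := by
  obtain ⟨a, ha⟩ := exists_smul_eq_mk_rep L v hv
  rw [frobP1, mk_eq_mk_iff']
  refine ⟨(a : L) ^ q, funext fun i => ?_⟩
  simp [← ha, Units.smul_def, mul_pow]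

theorem PGL2.mk_smul_mk {K : Type*} [Field K] (g : GL (Fin 2) K)
    (v : Fin 2 → AlgebraicClosure K) (hv : v ≠ 0)
    (hv' : ((g : Matrix (Fin 2) (Fin 2) K).map (algebraMap K (AlgebraicClosure K))).mulVec v ≠ 0) :
    (QuotientGroup.mk g : PGL2 K) • mk (AlgebraicClosure K) v hv = mk (AlgebraicClosure K) _ hv' := by
  change Projectivization.map (glMulEquiv _ (Matrix.GeneralLinearGroup.map
    (algebraMap K (AlgebraicClosure K)) g)).toLinearMap
    (glMulEquiv _ _).injective (mk _ v hv) = _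
  rw [map_mk, mk_eq_mk_iff']
  exact ⟨1, by simp [glMulEquiv_apply]⟩

theorem PGL2.mulVec_ne_zero {K : Type*} [Field K] (g : GL (Fin 2) K)
    {v : Fin 2 → AlgebraicClosure K} (hv : v ≠ 0) :
    ((g : Matrix (Fin 2) (Fin 2) K).map (algebraMap K (AlgebraicClosure K))).mulVec v ≠ 0 := by
  have h := (glMulEquiv _ (Matrix.GeneralLinearGroup.map
    (algebraMap K (AlgebraicClosure K)) g)).map_ne_zero_iff.2 hv
  rwa [glMulEquiv_apply] at h

theorem PGL2.smul_frobP1 {K : Type*} [Field K] [Fintype K] (g : PGL2 K)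
    (x : Projectivization (AlgebraicClosure K) (Fin 2 → AlgebraicClosure K)) :
    frobP1 (Fintype.card K) (g • x) = g • frobP1 (Fintype.card K) x := by
  have pow_ne {v : Fin 2 → AlgebraicClosure K} (hv : v ≠ 0) :
      (fun i => v i ^ Fintype.card K) ≠ 0 := fun h => hv <| funext fun i => by
    simpa using (pow_eq_zero_iff'.1 (congrFun h i)).1
  induction g using QuotientGroup.induction_on with
  | H g =>
    induction x using Projectivization.ind with
    | h v hv =>
      rw [PGL2.mk_smul_mk g v hv (PGL2.mulVec_ne_zero g hv), frobP1_mk _ _ _ (pow_ne hv),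
        frobP1_mk _ _ _ (pow_ne (PGL2.mulVec_ne_zero g hv)),
        PGL2.mk_smul_mk g _ _ (PGL2.mulVec_ne_zero g (pow_ne hv)), mk_eq_mk_iff']
      refine ⟨1, funext fun i => ?_⟩
      have h := fun a => FiniteField.frobeniusAlgHom_apply (K := K) (R := AlgebraicClosure K) a
      simp [← h, -FiniteField.frobeniusAlgHom_apply, Matrix.mulVec, dotProduct]
      fin_cases i <;> rfl

theorem mk_affine_inj {L : Type*} [Field L] {a b : L} {ha hb} :
    mk L ![a, 1] ha = mk L ![b, 1] hb ↔ a = b := by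
  rw [mk_eq_mk_iff']
  constructor
  · rintro ⟨c, hc⟩
    have h0 := congrFun hc 0
    have h1 := congrFun hc 1
    simp at h0 h1
    simp [← h0, h1]
  · rintro rfl
    exact ⟨1, by simp⟩

theorem ncard_pow_card_pow_eq (K : Type*) [Field K] [Fintype K] {n : ℕ} (hn : n ≠ 0) :
    {a : AlgebraicClosure K | a ^ Fintype.card K ^ n = a}.ncard = Fintype.card K ^ n := by
  classical
  obtain ⟨p, _⟩ := CharP.exists K
  have : CharP (AlgebraicClosure K) p := charP_of_injective_algebraMap' K p
  have hp : (p : ℕ) ∣ Fintype.card K ^ n :=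
    dvd_pow ((CharP.cast_eq_zero_iff K p _).1 (Nat.cast_card_eq_zero K)) hn
  have hs := galois_poly_separable (K := AlgebraicClosure K) p (Fintype.card K ^ n) hp
  have h1 := Fintype.one_lt_card (α := K)
  have hd := FiniteField.X_pow_card_pow_sub_X_natDegree_eq (AlgebraicClosure K) hn h1
  have hz := FiniteField.X_pow_card_pow_sub_X_ne_zero (AlgebraicClosure K) hn h1
  have hc := Polynomial.card_rootSet_eq_natDegree (K := AlgebraicClosure K) hs
    (by simpa using IsAlgClosed.splits _)
  rw [hd] at hc
  rw [← Nat.card_eq_fintype_card, Nat.card_coe_set_eq] at hc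
  refine Eq.trans ?_ hc
  congr 1
  ext a
  simp [Polynomial.mem_rootSet, hz, sub_eq_zero]

theorem card_PGL2 (K : Type*) [Field K] [Fintype K] :
    (Nat.card (PGL2 K) : ℤ) = (Fintype.card K : ℤ) ^ 3 - Fintype.card K := by
  have h1 := Fintype.one_lt_card (α := K)
  have h := Subgroup.card_eq_card_quotient_mul_card_subgroup (scalarSubgroup K)
  have hs : Nat.card (scalarSubgroup K) = Fintype.card K - 1 := by
    have hinj : Function.Injective (Units.map
        ((Matrix.scalar (Fin 2)) : K →+* Matrix (Fin 2) (Fin 2) K).toMonoidHom) :=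
      Units.map_injective fun _ _ h => Matrix.scalar_inj.1 h
    rw [scalarSubgroup, ← Nat.card_congr (MonoidHom.ofInjective hinj).toEquiv, Nat.card_units,
      Nat.card_eq_fintype_card]
  rw [hs, Matrix.card_GL_field] at h
  simp only [Fin.prod_univ_two, Fin.val_zero, Fin.val_one, pow_zero, pow_one] at h
  generalize Fintype.card K = q at *
  have h2 : q ≤ q ^ 2 := Nat.le_self_pow two_ne_zero q
  zify [h2, h1.le, h1.le.trans h2] at h
  have h3 : (q : ℤ) - 1 ≠ 0 := by lia
  refine mul_right_cancel₀ h3 ?_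
  rw [← h]
  ring

/-- The number of `6`-tuples of distinct points formed by three pairs of points exchanged by `f`,
in terms of the number of points that `f` moves and `f ∘ f` fixes. -/
theorem card_conjugate_tuples {P : Type*} (f : P → P)
    (hS : {x | f (f x) = x ∧ f x ≠ x}.Finite) :
    Nat.card {x : Fin 6 → P // Function.Injective x ∧ f (x 0) = x 1 ∧ f (x 1) = x 0 ∧
      f (x 2) = x 3 ∧ f (x 3) = x 2 ∧ f (x 4) = x 5 ∧ f (x 5) = x 4} =
      {x | f (f x) = x ∧ f x ≠ x}.ncard * (({x | f (f x) = x ∧ f x ≠ x}.ncard - 2) *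
        ({x | f (f x) = x ∧ f x ≠ x}.ncard - 4)) := by
  classical
  obtain ⟨S, hS⟩ := hS.exists_finset_coe
  have hmem (x) : x ∈ S ↔ f (f x) = x ∧ f x ≠ x := by rw [← Finset.mem_coe, hS]; rfl
  rw [← hS, Set.ncard_coe_finset]
  let F : Finset (Σ _ : P, Σ _ : P, P) := S.sigma fun a => (S \ {a, f a}).sigma fun b =>
    S \ {a, f a, b, f b}
  have hF : F.card = S.card * ((S.card - 2) * (S.card - 4)) := by
    rw [Finset.card_sigma, Finset.sum_const_nat fun a ha => ?_]
    rw [Finset.card_sigma, Finset.sum_const_nat (m := S.card - 4) fun b hb => ?_]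
    · rw [Finset.card_sdiff_of_subset (by grind), Finset.card_pair (by grind)]
    · rw [Finset.card_sdiff_of_subset (by grind)]
      congr 1
      rw [Finset.card_insert_of_notMem (by grind), Finset.card_insert_of_notMem (by grind),
        Finset.card_pair (by grind)]
  rw [← hF, ← Nat.card_eq_finsetCard F]
  refine Nat.card_congr
    { toFun := fun x => ⟨⟨x.1 0, x.1 2, x.1 4⟩, ?_⟩
      invFun := fun t => ⟨![t.1.1, f t.1.1, t.1.2.1, f t.1.2.1, t.1.2.2, f t.1.2.2], ?_⟩
      left_inv := ?_
      right_inv := ?_ }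
  · obtain ⟨x, hi, h⟩ := x
    have hne (i j) : i ≠ j → x i ≠ x j := hi.ne
    have := hne 0 1
    have := hne 0 2
    have := hne 0 3
    have := hne 0 4
    have := hne 0 5
    have := hne 1 2
    have := hne 1 4
    have := hne 2 3
    have := hne 2 4
    have := hne 3 4
    have := hne 4 5
    simp only [F, Finset.mem_sigma, Finset.mem_sdiff, Finset.mem_insert, Finset.mem_singleton,
      hmem]
    grind
  · obtain ⟨⟨a, b, c⟩, ht⟩ := t
    simp only [F, Finset.mem_sigma, Finset.mem_sdiff, Finset.mem_insert, Finset.mem_singleton,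
      hmem] at ht
    obtain ⟨⟨ha, ha'⟩, ⟨⟨hb, hb'⟩, hb2⟩, ⟨hc, hc'⟩, hc2⟩ := ht
    refine ⟨fun i j hij => ?_, rfl, ha, rfl, hb, rfl, hc⟩
    fin_cases i <;> fin_cases j <;> first | rfl | (exfalso; simp at hij; grind)
  · rintro ⟨x, hi, h01, -, h23, -, h45, -⟩
    refine Subtype.ext (funext fun i => ?_)
    fin_cases i <;> simp [h01, h23, h45]
  · rintro ⟨⟨a, b, c⟩, ht⟩
    rfl

/-- The projective line over the algebraic closure of `K`. -/
abbrev P1bar (K : Type*) [Field K] :=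
  Projectivization (AlgebraicClosure K) (Fin 2 → AlgebraicClosure K)

theorem exists_affine_of_frobP1_ne {K : Type*} [Field K] {q : ℕ} (hq : q ≠ 0)
    {x : P1bar K} (hx : frobP1 q x ≠ x) :
    ∃ a : AlgebraicClosure K, x = mk _ ![a, 1] (by simp) := by
  induction x using Projectivization.ind with
  | h v hv =>
    by_cases h1 : v 1 = 0
    · refine absurd ?_ hx
      have h0 : v 0 ≠ 0 := fun h0 => hv <| funext fun i => by fin_cases i <;> simp [h0, h1]
      rw [frobP1_mk q v hv fun h => h0 (pow_eq_zero_iff hq |>.1 (congrFun h 0)), mk_eq_mk_iff']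
      refine ⟨v 0 ^ q / v 0, funext fun i => ?_⟩
      fin_cases i <;> simp [h0, h1, hq]
    · refine ⟨v 0 / v 1, ?_⟩
      rw [mk_eq_mk_iff']
      refine ⟨v 1, funext fun i => ?_⟩
      fin_cases i <;> simp [h1, mul_div_cancel₀]

theorem frobP1_affine {L : Type*} [Field L] (q : ℕ) (a : L) :
    frobP1 q (mk L ![a, 1] (by simp)) = mk L ![a ^ q, 1] (by simp) := by
  have h : (fun i => (![a, 1] : Fin 2 → L) i ^ q) = ![a ^ q, 1] := by
    funext i; fin_cases i <;> simp
  rw [frobP1_mk q _ _ (by rw [h]; simp)]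
  simp only [h]

theorem ncard_frobP1_two_cycle (K : Type*) [Field K] [Fintype K] :
    {x : P1bar K | frobP1 (Fintype.card K) (frobP1 (Fintype.card K) x) = x ∧
      frobP1 (Fintype.card K) x ≠ x}.ncard = Fintype.card K ^ 2 - Fintype.card K := by
  have hq : Fintype.card K ≠ 0 := Fintype.card_ne_zero
  have h1 := ncard_pow_card_pow_eq K one_ne_zero
  have h2 := ncard_pow_card_pow_eq K two_ne_zero
  rw [pow_one] at h1
  have hsub : {a : AlgebraicClosure K | a ^ Fintype.card K = a} ⊆
      {a | a ^ Fintype.card K ^ 2 = a} := fun a ha => by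
    simp only [Set.mem_ofPred_eq] at ha ⊢
    rw [sq, pow_mul, ha, ha]
  have hfin := Set.finite_of_ncard_ne_zero (h1.trans_ne hq)
  have hd := Set.ncard_sdiff hsub hfin
  rw [h1, h2] at hd
  rw [← hd, ← Set.ncard_image_of_injective (f := fun a : AlgebraicClosure K =>
    (mk _ ![a, 1] (by simp) : P1bar K)) _ fun a b h => mk_affine_inj.1 h]
  congr 1
  ext x
  simp only [Set.mem_ofPred_eq, Set.mem_image, Set.mem_sdiff]
  constructor
  · rintro ⟨hx, hx'⟩
    obtain ⟨a, rfl⟩ := exists_affine_of_frobP1_ne hq hx'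
    refine ⟨a, ?_, rfl⟩
    simpa [frobP1_affine, mk_affine_inj, sq, pow_mul] using And.intro hx hx'
  · rintro ⟨a, ha, rfl⟩
    simpa [frobP1_affine, mk_affine_inj, sq, pow_mul] using ha

/-- An element of `PGL₂(K)` fixing three distinct affine points is trivial. -/
theorem PGL2.eq_one_of_smul_affine {K : Type*} [Field K] (g : PGL2 K)
    {x y z : AlgebraicClosure K} (hxy : x ≠ y) (hyz : y ≠ z) (hxz : x ≠ z)
    (hx : g • (mk _ ![x, 1] (by simp) : P1bar K) = mk _ ![x, 1] (by simp))
    (hy : g • (mk _ ![y, 1] (by simp) : P1bar K) = mk _ ![y, 1] (by simp))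
    (hz : g • (mk _ ![z, 1] (by simp) : P1bar K) = mk _ ![z, 1] (by simp)) : g = 1 := by
  induction g using QuotientGroup.induction_on with
  | H g =>
    set A := algebraMap K (AlgebraicClosure K) with hA
    have key {t : AlgebraicClosure K}
        (ht : (g : PGL2 K) • (mk _ ![t, 1] (by simp) : P1bar K) = mk _ ![t, 1] (by simp)) :
        A (g 1 0) * t ^ 2 + (A (g 1 1) - A (g 0 0)) * t - A (g 0 1) = 0 := by
      rw [PGL2.mk_smul_mk g _ _ (PGL2.mulVec_ne_zero g (by simp)), mk_eq_mk_iff'] at ht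
      obtain ⟨c, hc⟩ := ht
      have h0 := congrFun hc 0
      have h1 := congrFun hc 1
      simp [Matrix.mulVec, dotProduct, Fin.sum_univ_two, ← hA] at h0 h1
      rw [h1] at h0
      linear_combination h0
    have hx := key hx
    have hy := key hy
    have hz := key hz
    have e1 : A (g 1 0) * (x + y) + (A (g 1 1) - A (g 0 0)) = 0 :=
      mul_left_cancel₀ (sub_ne_zero.2 hxy) (by linear_combination hx - hy)
    have e2 : A (g 1 0) * (x + z) + (A (g 1 1) - A (g 0 0)) = 0 :=
      mul_left_cancel₀ (sub_ne_zero.2 hxz) (by linear_combination hx - hz)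
    have e3 : A (g 1 0) = 0 :=
      mul_left_cancel₀ (sub_ne_zero.2 hyz) (by linear_combination e1 - e2)
    have e4 : A (g 1 1) = A (g 0 0) := by linear_combination e1 - (x + y) * e3
    have e5 : A (g 0 1) = 0 := by linear_combination -hx + x ^ 2 * e3 + x * e4
    rw [map_eq_zero] at e3 e5
    have e4 := A.injective e4
    have hdet := g.det_ne_zero
    rw [Matrix.det_fin_two, e3, e5, e4] at hdet
    have h0 : g 0 0 ≠ 0 := fun h => hdet (by simp [h])
    rw [QuotientGroup.eq_one_iff]
    refine ⟨Units.mk0 _ h0, ?_⟩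
    ext i j
    fin_cases i <;> fin_cases j <;> simp [e3, e4, e5]

/-- The `6`-tuples of distinct points made of three pairs of Frobenius-conjugate points. -/
def conjugateTuples (K : Type*) [Field K] [Fintype K] :
    SubMulAction (PGL2 K) (Fin 6 → P1bar K) where
  carrier := {x | Function.Injective x ∧
    frobP1 (Fintype.card K) (x 0) = x 1 ∧ frobP1 (Fintype.card K) (x 1) = x 0 ∧
    frobP1 (Fintype.card K) (x 2) = x 3 ∧ frobP1 (Fintype.card K) (x 3) = x 2 ∧
    frobP1 (Fintype.card K) (x 4) = x 5 ∧ frobP1 (Fintype.card K) (x 5) = x 4}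
  smul_mem' g x hx := by
    obtain ⟨hi, h⟩ := hx
    refine ⟨(MulAction.injective g).comp hi, ?_⟩
    simpa [PGL2.smul_frobP1] using h

theorem stabilizer_conjugateTuples (K : Type*) [Field K] [Fintype K] (x : conjugateTuples K) :
    MulAction.stabilizer (PGL2 K) x = ⊥ := by
  obtain ⟨x, hi, h01, -, h23, -, h45, -⟩ := x
  have affine {i j} (hij : frobP1 (Fintype.card K) (x i) = x j) (hne : j ≠ i) :=
    exists_affine_of_frobP1_ne Fintype.card_ne_zero (hij.trans_ne (hi.ne hne))
  obtain ⟨a, ha⟩ := affine h01 (by decide)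
  obtain ⟨b, hb⟩ := affine h23 (by decide)
  obtain ⟨c, hc⟩ := affine h45 (by decide)
  rw [eq_bot_iff]
  intro g hg
  have hg (i) : g • x i = x i := congrFun (congrArg Subtype.val hg) i
  refine PGL2.eq_one_of_smul_affine g ?_ ?_ ?_ (ha ▸ hg 0) (hb ▸ hg 2) (hc ▸ hg 4)
  · rintro rfl
    exact absurd (hi (ha.trans hb.symm)) (by decide)
  · rintro rfl
    exact absurd (hi (hb.trans hc.symm)) (by decide)
  · rintro rfl
    exact absurd (hi (ha.trans hc.symm)) (by decide)

/-- the number of `PGL₂(K)`-orbits of injective 6-tuples on `P¹(K̄)`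
satisfying the stated Frobenius conditions. -/
theorem statement6 (q : ℕ) (hq : IsPrimePow q)
    (K : Type*) [Field K] [Fintype K] (hK : Fintype.card K = q) :
    (Nat.card (Quotient (Setoid.comap
      (Subtype.val :
        {x : Fin 6 → Projectivization (AlgebraicClosure K) (Fin 2 → AlgebraicClosure K) //
          Function.Injective x ∧
          frobP1 q (x 0) = x 1 ∧
          frobP1 q (x 1) = x 0 ∧
          frobP1 q (x 2) = x 3 ∧
          frobP1 q (x 3) = x 2 ∧
          frobP1 q (x 4) = x 5 ∧
          frobP1 q (x 5) = x 4} →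
        (Fin 6 → Projectivization (AlgebraicClosure K) (Fin 2 → AlgebraicClosure K)))
      (MulAction.orbitRel (PGL2 K)
        (Fin 6 → Projectivization (AlgebraicClosure K) (Fin 2 → AlgebraicClosure K))))) : ℤ)
    = (q : ℤ) ^ 3 - 3 * (q : ℤ) ^ 2 - 2 * (q : ℤ) + 8 := by
  subst hK
  change (Nat.card (Quotient ((MulAction.orbitRel (PGL2 K) (Fin 6 → P1bar K)).comap
    (Subtype.val : conjugateTuples K → _))) : ℤ) = _
  rw [← SubMulAction.orbitRel_of_subMul]
  have h := Nat.card_congr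
    (MulAction.selfEquivOrbitsQuotientProd (stabilizer_conjugateTuples K))
  have h1 := Fintype.one_lt_card (α := K)
  have hN := ncard_frobP1_two_cycle K
  have hpos : 0 < Fintype.card K ^ 2 - Fintype.card K :=
    Nat.sub_pos_of_lt (by nlinarith)
  have hT : Nat.card (conjugateTuples K) = _ := card_conjugate_tuples
    (frobP1 (Fintype.card K)) (Set.finite_of_ncard_ne_zero (hN.trans_ne hpos.ne'))
  rw [hN] at hT
  rw [Nat.card_prod, hT] at h
  have hG := card_PGL2 K
  generalize Fintype.card K = q at *
  generalize Nat.card (PGL2 K) = G at *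
  generalize Nat.card (Quotient _) = n at *
  have h3 : (q : ℤ) ^ 3 - q ≠ 0 := by
    have : (2 : ℤ) ≤ q := by exact_mod_cast h1
    nlinarith [mul_pos (by lia : (0 : ℤ) < q) (by nlinarith : (0 : ℤ) < q ^ 2 - 1)]
  refine mul_right_cancel₀ h3 ?_
  rw [← hG, ← Nat.cast_mul, ← h, hG]
  rcases Nat.eq_or_lt_of_le h1 with rfl | h2
  · norm_num
  have hle : q ≤ q ^ 2 := by nlinarith
  have h4 : 4 ≤ q ^ 2 - q := Nat.le_sub_of_add_le (by nlinarith)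
  push_cast [hle, h4, (by lia : 2 ≤ q ^ 2 - q)]
  ring
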